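/- Let q be an irreducible transition matrix on S, C a nonempty proper subset of S, and s ∈ C. Then the expected exit time from C starting at s satisfies E_{s,q}[T_{C̄}] = (Σ_{g∈G(C\{s})} p(g) + Σ_{t∈C, t≠s} Σ_{g∈G_{s,t}(C\{t})} p(g)) / (Σ_{g∈G(C)} p(g)). -/

import Mathlib

open Finset

namespace PerturbedMC

variable {S : Type*} [Fintype S] [DecidableEq S]

/-- `q` is a (row-stochastic) transition matrix on `S`: `q s t` is the probability of moving
from `s` to `t`. -/
def IsTransition (q : Matrix S S ℝ) : Prop :=
  (∀ s t, 0 ≤ q s t) ∧ ∀ s, ∑ t, q s t = 1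

/-- `q` is irreducible. -/
def IsIrreducible (q : Matrix S S ℝ) : Prop :=
  ∀ s t, ∃ n : ℕ, 1 ≤ n ∧ 0 < (q ^ n) s t

/-- `μ` is a stationary distribution of `q`. -/
def IsStationary (q : Matrix S S ℝ) (μ : S → ℝ) : Prop :=
  (∀ s, 0 ≤ μ s) ∧ (∑ s, μ s = 1) ∧ ∀ t, ∑ s, μ s * q s t = μ t

/-- The combinatorial constant `L = ∑_{n=1}^{|S|-1} C(|S|,n) · n^{|S|}`. -/
def Lconst (S : Type*) [Fintype S] : ℕ :=
  ∑ n ∈ Finset.Ico 1 (Fintype.card S), (Fintype.card S).choose n * n ^ Fintype.card S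

/-- `ζ_q`: the minimal stationary outflow over nonempty proper subsets of `S`. -/
noncomputable def zeta (q : Matrix S S ℝ) (μ : S → ℝ) : ℝ :=
  sInf {x : ℝ | ∃ C : Finset S, C.Nonempty ∧ C ≠ Finset.univ ∧
    x = ∑ s ∈ C, μ s * ∑ t ∈ Cᶜ, q s t}

/-- `ζ_q^1`: the minimal stationary outflow over nonempty proper subsets of `S₁`. -/
noncomputable def zeta1 (q : Matrix S S ℝ) (μ : S → ℝ) (S1 : Finset S) : ℝ :=
  sInf {x : ℝ | ∃ C : Finset S, C.Nonempty ∧ C ⊂ S1 ∧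
    x = ∑ s ∈ C, μ s * ∑ t ∈ Cᶜ, q s t}

/-- `q̂` is `(ε,β)`-close to `q`, relative to the threshold `z` (`z = ζ_q` or `z = ζ_q^1`):
`|q̂(t|s) − q(t|s)| ≤ β·q(t|s)` whenever `μ_s q(t|s) ≥ ε·z` or `μ_s q̂(t|s) ≥ ε·z`. -/
def IsClose (q qh : Matrix S S ℝ) (μ : S → ℝ) (z ε β : ℝ) : Prop :=
  ∀ s t, (ε * z ≤ μ s * q s t ∨ ε * z ≤ μ s * qh s t) → |qh s t - q s t| ≤ β * q s t

/-- The substochastic `C × C` restriction `q_C` of `q`. -/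
def subMat (q : Matrix S S ℝ) (C : Finset S) : Matrix S S ℝ :=
  fun u v => if u ∈ C ∧ v ∈ C then q u v else 0

/-- The exit distribution `Q_{s,q}(t|C) = Σ_{n≥0} Σ_{u∈C} (q_C^n)(u|s)·q(t|u)`. -/
noncomputable def exitProb (q : Matrix S S ℝ) (C : Finset S) (s t : S) : ℝ :=
  ∑' n : ℕ, ∑ u ∈ C, ((subMat q C ^ n : Matrix S S ℝ) s u) * q u t

/-- The expected exit time `E_{s,q}[T_{C̄}] = Σ_{n≥0} Σ_{u∈C} (q_C^n)(u|s) ∈ [0,∞]`. -/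
noncomputable def expExit (q : Matrix S S ℝ) (C : Finset S) (s : S) : ENNReal :=
  ∑' n : ℕ, ENNReal.ofReal (∑ u ∈ C, (subMat q C ^ n : Matrix S S ℝ) s u)

/-- `g` has a cycle within `C`. -/
def HasCycle (C : Finset S) (g : S → S) : Prop :=
  ∃ (k : ℕ) (f : ℕ → S), 0 < k ∧ f k = f 0 ∧ (∀ i < k, f i ∈ C) ∧ ∀ i < k, g (f i) = f (i + 1)

/-- `g` is a `C`-graph (the values of `g` outside `C` are irrelevant). -/
def IsCGraph (C : Finset S) (g : S → S) : Prop := ¬ HasCycle C g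

/-- `s` leads to `t` along `g`: `t` is the first state outside `C` on the `g`-orbit of `s`. -/
def LeadsTo (C : Finset S) (g : S → S) (s t : S) : Prop :=
  ∃ n : ℕ, g^[n] s = t ∧ t ∉ C ∧ ∀ m < n, g^[m] s ∈ C

/-- The weight `p(g) = Π_{s∈C} q(g(s)|s)` of a `C`-graph under `q`. -/
def wt (q : Matrix S S ℝ) (C : Finset S) (g : S → S) : ℝ := ∏ s ∈ C, q s (g s)

/-- `G(C)`: the canonical representatives of `C`-graphs, namely the maps `S → S` that are
`C`-graphs and are the identity outside `C`. -/
noncomputable def Gset (C : Finset S) : Finset (S → S) :=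
  @Finset.filter _ (fun g => IsCGraph C g ∧ ∀ s ∉ C, g s = s) (Classical.decPred _) Finset.univ

/-- `G_{s,t}(C)`: the `C`-graphs along which `s` leads to `t`. -/
noncomputable def GsetLead (C : Finset S) (s t : S) : Finset (S → S) :=
  @Finset.filter _ (fun g => LeadsTo C g s t) (Classical.decPred _) (Gset C)

/-- `g` is an `η`-maximal `C`-graph under `q`: `p(g) ≥ η · max_{g' ∈ G(C)} p(g')`. -/
def IsMaximal (q : Matrix S S ℝ) (C : Finset S) (η : ℝ) (g : S → S) : Prop :=
  IsCGraph C g ∧ ∀ g', IsCGraph C g' → η * wt q C g' ≤ wt q C g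

/-- `H = G^β(C) ∪ Ĝ^β(C)` as a finset of canonical representatives. -/
noncomputable def Hset (q qh : Matrix S S ℝ) (C : Finset S) (β : ℝ) : Finset (S → S) :=
  @Finset.filter _ (fun g => IsMaximal q C β g ∨ IsMaximal qh C β g)
    (Classical.decPred _) (Gset C)

/-- The mixing hypothesis with parameter `a` on `S₁`: for all `s,t ∈ S₁`, the probability
that the chain started at `s`, from its first step onward, reaches `t` before reaching any
state of `S \ S₁`, is at least `a`. -/
def Mixing (q : Matrix S S ℝ) (S1 : Finset S) (a : ℝ) : Prop :=
  ∀ s ∈ S1, ∀ t ∈ S1,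
    a ≤ q s t + ∑ u ∈ S1.erase t, q s u * exitProb q (S1.erase t) u t

/-- `R` is a recurrent class for `q`. -/
def IsRecClass (q : Matrix S S ℝ) (R : Finset S) : Prop :=
  (∀ s ∈ R, ∑ t ∈ Rᶜ, q s t = 0) ∧
    ∀ s ∈ R, ∀ t ∈ R, ∃ n : ℕ, 1 ≤ n ∧ 0 < (q ^ n) s t

section LeadsTo

variable {C : Finset S} {g : S → S} {s t x y : S}

omit [Fintype S] [DecidableEq S] in
theorem LeadsTo.refl (g : S → S) (ht : t ∉ C) : LeadsTo C g t t :=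
  ⟨0, rfl, ht, fun _ hm => absurd hm (Nat.not_lt_zero _)⟩

omit [Fintype S] [DecidableEq S] in
theorem LeadsTo.notMem (h : LeadsTo C g s t) : t ∉ C := by
  obtain ⟨_, _, ht, _⟩ := h
  exact ht

omit [Fintype S] [DecidableEq S] in
theorem LeadsTo.step (hs : s ∈ C) (h : LeadsTo C g (g s) t) : LeadsTo C g s t := by
  obtain ⟨n, hn, ht, hm⟩ := h
  refine ⟨n + 1, hn, ht, fun m hlt => ?_⟩
  cases m with
  | zero => exact hs
  | succ m => exact hm m (by omega)

omit [Fintype S] [DecidableEq S] in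
theorem LeadsTo.of_step (hs : s ∈ C) (h : LeadsTo C g s t) : LeadsTo C g (g s) t := by
  obtain ⟨n, hn, ht, hm⟩ := h
  cases n with
  | zero => exact absurd hs (by rw [show s = t from hn]; exact ht)
  | succ n => exact ⟨n, hn, ht, fun m hlt => hm (m + 1) (by omega)⟩

omit [Fintype S] [DecidableEq S] in
theorem LeadsTo.eq_of_notMem (hs : s ∉ C) (h : LeadsTo C g s t) : s = t := by
  obtain ⟨n, hn, ht, hm⟩ := h
  cases n with
  | zero => exact hn
  | succ n => exact absurd (hm 0 (by omega)) hs

omit [Fintype S] [DecidableEq S] in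
theorem LeadsTo.induct {P : S → Prop} (h : LeadsTo C g s t) (base : t ∉ C → P t)
    (ind : ∀ x ∈ C, LeadsTo C g (g x) t → P (g x) → P x) : P s := by
  obtain ⟨n, hn⟩ := id h
  induction n generalizing s with
  | zero => obtain ⟨rfl, ht, -⟩ := hn; exact base ht
  | succ n ih =>
    have hs : s ∈ C := hn.2.2 0 (by omega)
    refine ind s hs (h.of_step hs) (ih (h.of_step hs) ?_)
    exact ⟨hn.1, hn.2.1, fun m hlt => hn.2.2 (m + 1) (by omega)⟩

omit [Fintype S] [DecidableEq S] in
theorem LeadsTo.unique (h : LeadsTo C g s x) (h' : LeadsTo C g s y) : x = y := by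
  revert h'
  exact h.induct (P := fun s => LeadsTo C g s y → x = y) (fun hx h' => h'.eq_of_notMem hx)
    fun z hz _ ih h' => ih (h'.of_step hz)

omit [Fintype S] [DecidableEq S] in
theorem LeadsTo.not_forall_iterate_mem (h : LeadsTo C g s t) : ¬ ∀ n, g^[n] s ∈ C := by
  obtain ⟨n, rfl, ht, -⟩ := h
  exact fun hall => ht (hall n)

omit [Fintype S] [DecidableEq S] in
theorem isCGraph_of_forall_leadsTo (h : ∀ x, ∃ y, LeadsTo C g x y) : IsCGraph C g := by
  rintro ⟨k, f, hk, hfk, hfC, hgf⟩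
  have hit : ∀ i ≤ k, g^[i] (f 0) = f i := by
    intro i
    induction i with
    | zero => intro _; rfl
    | succ i ih =>
      intro hi
      rw [Function.iterate_succ_apply', ih (by omega), hgf i (by omega)]
  have hper : Function.IsPeriodicPt g k (f 0) := (hit k le_rfl).trans hfk
  obtain ⟨y, hy⟩ := h (f 0)
  refine hy.not_forall_iterate_mem fun n => ?_
  rw [← hper.iterate_mod_apply n, hit _ (Nat.mod_lt _ hk).le]
  exact hfC _ (Nat.mod_lt _ hk)

theorem IsCGraph.exists_leadsTo (h : IsCGraph C g) (x : S) : ∃ y, LeadsTo C g x y := by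
  classical
  have hex : ∃ n, g^[n] x ∉ C := by
    by_contra! hall
    refine h ?_
    obtain ⟨i, j, hij, heq⟩ := Finite.exists_ne_map_eq_of_infinite fun n : ℕ => g^[n] x
    wlog hlt : i < j generalizing i j
    · exact this j i hij.symm heq.symm (by omega)
    refine ⟨j - i, fun k => g^[i + k] x, by omega, ?_, fun k _ => hall _, fun k _ => ?_⟩
    · simpa [Nat.add_sub_cancel' hlt.le] using heq.symm
    · exact (Function.iterate_succ_apply' g (i + k) x).symm
  exact ⟨_, Nat.find hex, rfl, Nat.find_spec hex, fun m hm => not_not.1 (Nat.find_min hex hm)⟩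

omit [Fintype S] in
theorem LeadsTo.update_of_ne {z : S} (hx : LeadsTo C g x y) (hs : LeadsTo C g s z) (hyz : y ≠ z)
    (v : S) : LeadsTo C (Function.update g s v) x y := by
  refine hx.induct (P := fun x => LeadsTo C (Function.update g s v) x y) (LeadsTo.refl _) ?_
  intro x hxC hgx ih
  have hxs : x ≠ s := by
    rintro rfl
    exact hyz ((hgx.step hxC).unique hs)
  refine LeadsTo.step hxC ?_
  rwa [Function.update_of_ne hxs]

omit [Fintype S] in
/-- The path followed after leaving `s` never returns to `s`, so redirecting `s` does not
affect it. -/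
theorem LeadsTo.update_apply (hsC : s ∈ C) (hs : LeadsTo C g s t) (v : S) :
    LeadsTo C (Function.update g s v) (g s) t := by
  obtain ⟨n, hn, ht, hlt⟩ := hs.of_step hsC
  have hmem : ∀ m < n + 1, g^[m] s ∈ C := by
    rintro (_ | m) hm
    · exact hsC
    · exact hlt m (by omega)
  have hne : ∀ m < n, g^[m] (g s) ≠ s := by
    intro m hmn hm
    have hper : Function.IsPeriodicPt g (m + 1) s := hm
    refine hs.not_forall_iterate_mem fun k => ?_
    rw [← hper.iterate_mod_apply k]
    exact hmem _ ((Nat.mod_lt _ (Nat.succ_pos m)).trans_le (by omega))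
  have hit : ∀ m ≤ n, (Function.update g s v)^[m] (g s) = g^[m] (g s) := by
    intro m
    induction m with
    | zero => intro _; rfl
    | succ m ih =>
      intro hm
      rw [Function.iterate_succ_apply', ih (by omega), Function.update_of_ne (hne m (by omega)),
        Function.iterate_succ_apply']
  exact ⟨n, (hit n le_rfl).trans hn, ht, fun m hm => by rw [hit m hm.le]; exact hlt m hm⟩

theorem IsCGraph.update (hg : IsCGraph C g) {v : S}
    (hs : LeadsTo C (Function.update g s v) s t) : IsCGraph C (Function.update g s v) := by
  refine isCGraph_of_forall_leadsTo fun x => ?_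
  obtain ⟨z, hz⟩ := hg.exists_leadsTo x
  refine hz.induct (P := fun x => ∃ y, LeadsTo C (Function.update g s v) x y)
    (fun h => ⟨z, LeadsTo.refl _ h⟩) ?_
  rintro x hxC - ⟨y, hy⟩
  by_cases hxs : x = s
  · exact ⟨t, hxs ▸ hs⟩
  · refine ⟨y, LeadsTo.step hxC ?_⟩
    rwa [Function.update_of_ne hxs]

omit [Fintype S] in
theorem LeadsTo.update_self {v : S} (hsC : s ∈ C) (hs : LeadsTo C g s x) (hv : LeadsTo C g v y)
    (hxy : x ≠ y) : LeadsTo C (Function.update g s v) s y := by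
  refine LeadsTo.step hsC ?_
  rw [Function.update_self]
  exact hv.update_of_ne hs hxy.symm v

omit [Fintype S] in
theorem LeadsTo.update_of_erase (hx : LeadsTo (C.erase s) g x y) (hy : y ∉ C) (v : S) :
    LeadsTo C (Function.update g s v) x y := by
  refine hx.induct (P := fun x => LeadsTo C (Function.update g s v) x y)
    (fun _ => LeadsTo.refl _ hy) ?_
  intro x hxC _ ih
  refine LeadsTo.step (mem_of_mem_erase hxC) ?_
  rwa [Function.update_of_ne (ne_of_mem_erase hxC)]

theorem IsCGraph.update_of_erase (hsC : s ∈ C) (hg : IsCGraph (C.erase s) g) {v : S}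
    (hv : ¬ LeadsTo (C.erase s) g v s) : IsCGraph C (Function.update g s v) := by
  have hout : ∀ {y}, y ∉ C.erase s → y ≠ s → y ∉ C := fun hy hys hyC =>
    hy (mem_erase.2 ⟨hys, hyC⟩)
  obtain ⟨y, hy⟩ := hg.exists_leadsTo v
  have hys : y ≠ s := by rintro rfl; exact hv hy
  have hs : LeadsTo C (Function.update g s v) s y := by
    refine LeadsTo.step hsC ?_
    rw [Function.update_self]
    exact hy.update_of_erase (hout hy.notMem hys) v
  refine isCGraph_of_forall_leadsTo fun x => ?_
  obtain ⟨z, hz⟩ := hg.exists_leadsTo x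
  refine hz.induct (P := fun x => ∃ y, LeadsTo C (Function.update g s v) x y) (fun h => ?_) ?_
  · by_cases hzs : z = s
    · exact ⟨y, hzs ▸ hs⟩
    · exact ⟨z, LeadsTo.refl _ (hout h hzs)⟩
  · rintro x hxC - ⟨w, hw⟩
    refine ⟨w, LeadsTo.step (mem_of_mem_erase hxC) ?_⟩
    rwa [Function.update_of_ne (ne_of_mem_erase hxC)]

theorem IsCGraph.erase_update (hg : IsCGraph C g) (s v : S) :
    IsCGraph (C.erase s) (Function.update g s v) := by
  refine isCGraph_of_forall_leadsTo fun x => ?_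
  obtain ⟨z, hz⟩ := hg.exists_leadsTo x
  refine hz.induct (P := fun x => ∃ y, LeadsTo (C.erase s) (Function.update g s v) x y)
    (fun h => ⟨z, LeadsTo.refl _ fun h' => h (mem_of_mem_erase h')⟩) ?_
  rintro x hxC - ⟨y, hy⟩
  by_cases hxs : x = s
  · exact ⟨x, LeadsTo.refl _ (hxs ▸ notMem_erase s C)⟩
  · refine ⟨y, LeadsTo.step (mem_erase.2 ⟨hxs, hxC⟩) ?_⟩
    rwa [Function.update_of_ne hxs]

theorem IsCGraph.not_leadsTo_erase_update (hg : IsCGraph C g) (hsC : s ∈ C) :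
    ¬ LeadsTo (C.erase s) (Function.update g s s) (g s) s := by
  intro h
  obtain ⟨z, hz⟩ := hg.exists_leadsTo s
  have hgs := hz.update_apply hsC s
  revert hgs
  refine h.induct (P := fun x => ¬ LeadsTo C (Function.update g s s) x z) ?_ ?_
  · intro _ hs
    refine hs.not_forall_iterate_mem fun n => ?_
    rwa [Function.iterate_fixed (Function.update_self ..)]
  · exact fun x hxC _ ih hx => ih (hx.of_step (mem_of_mem_erase hxC))

end LeadsTo

section Sums

variable {C : Finset S} {g : S → S} {s t : S}

theorem mem_Gset : g ∈ Gset C ↔ IsCGraph C g ∧ ∀ x ∉ C, g x = x := by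
  simp [Gset]

theorem mem_GsetLead : g ∈ GsetLead C s t ↔ g ∈ Gset C ∧ LeadsTo C g s t := by
  simp [GsetLead]

theorem GsetLead_self (ht : t ∉ C) : GsetLead C t t = Gset C := by
  ext g
  simp [mem_GsetLead, LeadsTo.refl g ht]

theorem GsetLead_eq_empty (hs : s ∉ C) (hst : s ≠ t) : GsetLead C s t = ∅ := by
  ext g
  simpa [mem_GsetLead] using fun _ h => hst (LeadsTo.eq_of_notMem hs h)

omit [Fintype S] in
theorem wt_update_of_notMem (q : Matrix S S ℝ) (hs : s ∉ C) (g : S → S) (v : S) :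
    wt q C (Function.update g s v) = wt q C g :=
  prod_congr rfl fun x hx => by rw [Function.update_of_ne (by rintro rfl; exact hs hx)]

omit [Fintype S] in
theorem wt_eq_mul_erase (q : Matrix S S ℝ) (hs : s ∈ C) (g : S → S) :
    wt q C g = q s (g s) * wt q (C.erase s) g :=
  (mul_prod_erase C _ hs).symm

omit [Fintype S] in
theorem wt_update (q : Matrix S S ℝ) (hs : s ∈ C) (g : S → S) (v : S) :
    q s (g s) * wt q C (Function.update g s v) = q s v * wt q C g := by
  rw [wt_eq_mul_erase q hs, wt_eq_mul_erase q hs g, wt_update_of_notMem q (notMem_erase s C),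
    Function.update_self]
  ring

theorem update_mem_Gset (hg : g ∈ Gset C) (hs : s ∈ C) {v : S}
    (hlead : LeadsTo C (Function.update g s v) s t) : Function.update g s v ∈ Gset C := by
  rw [mem_Gset] at hg ⊢
  refine ⟨hg.1.update hlead, fun x hx => ?_⟩
  rw [Function.update_of_ne (by rintro rfl; exact hx hs), hg.2 x hx]

/-- First-step equation for graphs along which `s` leads to `t`, when `s ∈ C`. -/
theorem sum_wt_GsetLead_step {q : Matrix S S ℝ} (hq : IsTransition q) (hs : s ∈ C) (t : S) :
    ∑ g ∈ GsetLead C s t, wt q C g = ∑ u, q s u * ∑ g ∈ GsetLead C u t, wt q C g := by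
  classical
  have hleft : ∑ g ∈ GsetLead C s t, wt q C g =
      ∑ p ∈ (univ ×ˢ Gset C : Finset (S × (S → S))) with LeadsTo C p.2 s t,
        q s p.1 * wt q C p.2 := by
    rw [sum_filter, sum_product_right]
    simp only [GsetLead, sum_filter]
    refine sum_congr (by congr) fun g _ => ?_
    split_ifs
    · rw [← sum_mul, hq.2 s, one_mul]
    · simp
  have hright : ∑ u, q s u * ∑ g ∈ GsetLead C u t, wt q C g =
      ∑ p ∈ (univ ×ˢ Gset C : Finset (S × (S → S))) with LeadsTo C p.2 p.1 t,
        q s p.1 * wt q C p.2 := by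
    rw [sum_filter, sum_product]
    refine sum_congr rfl fun u _ => ?_
    simp only [GsetLead, sum_filter, mul_sum, mul_ite, mul_zero]
  rw [hleft, hright, ← sum_filter_add_sum_filter_not _ (fun p => LeadsTo C p.2 p.1 t),
    ← sum_filter_add_sum_filter_not
      (filter (fun p : S × (S → S) => LeadsTo C p.2 p.1 t) (univ ×ˢ Gset C))
      (fun p => LeadsTo C p.2 s t)]
  congr 1
  · rw [filter_comm]
  · refine sum_nbij' (fun p => (p.2 s, Function.update p.2 s p.1))
      (fun p => (p.2 s, Function.update p.2 s p.1)) ?_ ?_ ?_ ?_ ?_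
    · rintro ⟨v, g⟩ h
      simp only [mem_filter, mem_product, mem_univ, true_and] at h ⊢
      obtain ⟨⟨hg, hst⟩, hvt⟩ := h
      obtain ⟨y, hy⟩ := (mem_Gset.1 hg).1.exists_leadsTo v
      have hty : t ≠ y := by rintro rfl; exact hvt hy
      have hsy := hst.update_self hs hy hty
      exact ⟨⟨update_mem_Gset hg hs hsy, hst.update_apply hs v⟩, fun h => hty (h.unique hsy)⟩
    · rintro ⟨u, g⟩ h
      simp only [mem_filter, mem_product, mem_univ, true_and] at h ⊢
      obtain ⟨⟨hg, hut⟩, hst⟩ := h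
      obtain ⟨y, hy⟩ := (mem_Gset.1 hg).1.exists_leadsTo s
      have hyt : y ≠ t := by rintro rfl; exact hst hy
      have hst' := hy.update_self hs hut hyt
      exact ⟨⟨update_mem_Gset hg hs hst', hst'⟩,
        fun h => hyt ((hy.update_apply hs u).unique h)⟩
    · rintro ⟨v, g⟩ _
      simp
    · rintro ⟨v, g⟩ _
      simp
    · rintro ⟨v, g⟩ _
      exact (wt_update q hs g v).symm

/-- First-step equation for graphs on `C` without `s`: redirecting `s` to a state that does not
lead to `s` gives a graph on `C`. -/
theorem sum_wt_Gset_erase {q : Matrix S S ℝ} (hq : IsTransition q) (hs : s ∈ C) :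
    ∑ g ∈ Gset (C.erase s), wt q (C.erase s) g =
      ∑ u, q s u * ∑ g ∈ GsetLead (C.erase s) u s, wt q (C.erase s) g +
        ∑ g ∈ Gset C, wt q C g := by
  classical
  have hleft : ∑ g ∈ Gset (C.erase s), wt q (C.erase s) g =
      ∑ p ∈ (univ ×ˢ Gset (C.erase s) : Finset (S × (S → S))),
        q s p.1 * wt q (C.erase s) p.2 := by
    rw [sum_product_right]
    refine sum_congr rfl fun g _ => ?_
    simp only [← sum_mul, hq.2 s, one_mul]
  have hright : ∑ u, q s u * ∑ g ∈ GsetLead (C.erase s) u s, wt q (C.erase s) g =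
      ∑ p ∈ (univ ×ˢ Gset (C.erase s) : Finset (S × (S → S))) with LeadsTo (C.erase s) p.2 p.1 s,
        q s p.1 * wt q (C.erase s) p.2 := by
    rw [sum_filter, sum_product]
    refine sum_congr rfl fun u _ => ?_
    simp only [GsetLead, sum_filter, mul_sum, mul_ite, mul_zero]
  rw [hleft, hright, ← sum_filter_add_sum_filter_not _ (fun p => LeadsTo (C.erase s) p.2 p.1 s)]
  congr 1
  refine sum_nbij' (fun p => Function.update p.2 s p.1)
      (fun h => (h s, Function.update h s s)) ?_ ?_ ?_ ?_ ?_
  · rintro ⟨v, g⟩ h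
    simp only [mem_filter, mem_product, mem_univ, true_and, mem_Gset] at h ⊢
    refine ⟨h.1.1.update_of_erase hs h.2, fun x hx => ?_⟩
    rw [Function.update_of_ne (by rintro rfl; exact hx hs),
      h.1.2 x fun h' => hx (mem_of_mem_erase h')]
  · intro g h
    simp only [mem_filter, mem_product, mem_univ, true_and, mem_Gset] at h ⊢
    refine ⟨⟨h.1.erase_update s s, fun x hx => ?_⟩, h.1.not_leadsTo_erase_update hs⟩
    by_cases hxs : x = s
    · rw [hxs, Function.update_self]
    · rw [Function.update_of_ne hxs, h.2 x fun h' => hx (mem_erase.2 ⟨hxs, h'⟩)]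
  · rintro ⟨v, g⟩ h
    simp only [mem_filter, mem_product, mem_univ, true_and, mem_Gset] at h
    have hgs : g s = s := h.1.2 s (notMem_erase s C)
    simp [hgs]
  · intro g _
    simp
  · rintro ⟨v, g⟩ _
    rw [wt_eq_mul_erase q hs, wt_update_of_notMem q (notMem_erase s C), Function.update_self]

/-- The sum over `t ∈ C` of the weights of the graphs on `C` without `t` along which `s` leads
to `t`. -/
noncomputable def exitNumerator (q : Matrix S S ℝ) (C : Finset S) (s : S) : ℝ :=
  ∑ t ∈ C, ∑ g ∈ GsetLead (C.erase t) s t, wt q (C.erase t) g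

theorem exitNumerator_eq (q : Matrix S S ℝ) (hs : s ∈ C) :
    exitNumerator q C s = (∑ g ∈ Gset (C.erase s), wt q (C.erase s) g) +
      ∑ t ∈ C.erase s, ∑ g ∈ GsetLead (C.erase t) s t, wt q (C.erase t) g := by
  rw [exitNumerator, ← add_sum_erase C _ hs, GsetLead_self (notMem_erase s C)]

omit [DecidableEq S] in
theorem wt_nonneg {q : Matrix S S ℝ} (hq : IsTransition q) (C : Finset S) (g : S → S) :
    0 ≤ wt q C g :=
  prod_nonneg fun x _ => hq.1 x (g x)

theorem exitNumerator_nonneg {q : Matrix S S ℝ} (hq : IsTransition q) (C : Finset S) (s : S) :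
    0 ≤ exitNumerator q C s :=
  sum_nonneg fun _ _ => sum_nonneg fun _ _ => wt_nonneg hq _ _

theorem exitNumerator_eq_zero (q : Matrix S S ℝ) (hs : s ∉ C) : exitNumerator q C s = 0 := by
  refine sum_eq_zero fun t ht => ?_
  rw [GsetLead_eq_empty (fun h => hs (mem_of_mem_erase h)) (by rintro rfl; exact hs ht), sum_empty]

theorem exitNumerator_step {q : Matrix S S ℝ} (hq : IsTransition q) (hs : s ∈ C) :
    exitNumerator q C s =
      ∑ g ∈ Gset C, wt q C g + ∑ u, q s u * exitNumerator q C u := by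
  have hsum : ∑ u, q s u * exitNumerator q C u =
      ∑ t ∈ C, ∑ u, q s u * ∑ g ∈ GsetLead (C.erase t) u t, wt q (C.erase t) g := by
    simp only [exitNumerator, mul_sum (s := C)]
    exact sum_comm
  rw [exitNumerator_eq q hs, hsum, ← add_sum_erase C _ hs, sum_wt_Gset_erase hq hs,
    sum_congr rfl fun t ht => sum_wt_GsetLead_step hq
      (mem_erase.2 ⟨(ne_of_mem_erase ht).symm, hs⟩) t]
  ring

theorem sum_wt_Gset_pos {q : Matrix S S ℝ} (hq : IsTransition q) (hqirr : IsIrreducible q)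
    (hC : C ≠ univ) : 0 < ∑ g ∈ Gset C, wt q C g := by
  classical
  obtain ⟨t, ht⟩ : ∃ t, t ∉ C := by
    by_contra! h
    exact hC (eq_univ_iff_forall.2 h)
  have hex : ∀ x, ∃ n, (q ^ n) x t ≠ 0 := fun x =>
    let ⟨n, _, hn⟩ := hqirr x t
    ⟨n, hn.ne'⟩
  let d : S → ℕ := fun x => Nat.find (hex x)
  have hstep : ∀ x, ∃ y, x ∈ C → 0 < q x y ∧ d y < d x := by
    intro x
    by_cases hx : x ∈ C
    swap
    · exact ⟨x, fun h => absurd h hx⟩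
    have hd : (q ^ d x) x t ≠ 0 := Nat.find_spec (hex x)
    rcases hdx : d x with _ | n
    · rw [hdx, pow_zero, Matrix.one_apply_ne (by rintro rfl; exact ht hx)] at hd
      exact absurd rfl hd
    · rw [hdx, pow_succ', Matrix.mul_apply] at hd
      obtain ⟨y, -, hy⟩ := exists_ne_zero_of_sum_ne_zero hd
      refine ⟨y, fun _ => ⟨(hq.1 x y).lt_of_ne' (left_ne_zero_of_mul hy), ?_⟩⟩
      exact Nat.lt_succ_of_le (Nat.find_min' (hex y) (right_ne_zero_of_mul hy))
  choose f hf using hstep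
  let g : S → S := fun x => if x ∈ C then f x else x
  have hgC : ∀ x ∈ C, g x = f x := fun x hx => if_pos hx
  have hg : g ∈ Gset C := by
    refine mem_Gset.2 ⟨isCGraph_of_forall_leadsTo fun x => ?_, fun x hx => if_neg hx⟩
    induction hn : d x using Nat.strong_induction_on generalizing x with
    | _ n ih =>
      by_cases hx : x ∈ C
      · obtain ⟨y, hy⟩ := ih (d (g x)) (by rw [hgC x hx, ← hn]; exact (hf x hx).2) (g x) rfl
        exact ⟨y, hy.step hx⟩
      · exact ⟨x, LeadsTo.refl g hx⟩
  refine sum_pos' (fun g _ => wt_nonneg hq C g) ⟨g, hg, prod_pos fun x hx => ?_⟩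
  rw [hgC x hx]
  exact (hf x hx).1

end Sums

section ExitTime

variable {q : Matrix S S ℝ} {C : Finset S}

theorem subMat_pow_nonneg (hq : IsTransition q) (C : Finset S) (n : ℕ) (u v : S) :
    0 ≤ (subMat q C ^ n : Matrix S S ℝ) u v := by
  induction n generalizing v with
  | zero =>
    rw [pow_zero, Matrix.one_apply]
    split_ifs <;> norm_num
  | succ n ih =>
    rw [pow_succ, Matrix.mul_apply]
    refine sum_nonneg fun w _ => mul_nonneg (ih w) ?_
    rw [subMat]
    split_ifs
    exacts [hq.1 w v, le_rfl]

/-- A nonnegative solution of the first-step equations on `C` is the expected exit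
time. -/
theorem expExit_eq_ofReal (hq : IsTransition q) {h : S → ℝ} (hnonneg : ∀ s, 0 ≤ h s)
    (hout : ∀ s ∉ C, h s = 0) (hstep : ∀ s ∈ C, h s = 1 + ∑ u, q s u * h u) {s : S}
    (hs : s ∈ C) : expExit q C s = ENNReal.ofReal (h s) := by
  set a : ℕ → ℝ := fun n => ∑ u ∈ C, (subMat q C ^ n : Matrix S S ℝ) s u with ha
  set r : ℕ → ℝ := fun n => ∑ u ∈ C, (subMat q C ^ n : Matrix S S ℝ) s u * h u with hr
  have ha0 : ∀ n, 0 ≤ a n := fun n => sum_nonneg fun u _ => subMat_pow_nonneg hq C n s u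
  have hr0 : ∀ n, 0 ≤ r n := fun n =>
    sum_nonneg fun u _ => mul_nonneg (subMat_pow_nonneg hq C n s u) (hnonneg u)
  have hrec : ∀ n, r n = a n + r (n + 1) := by
    intro n
    have hsub : ∀ u ∈ C, ∑ v ∈ C, subMat q C u v * h v = ∑ v, q u v * h v := by
      intro u hu
      rw [← sum_subset (subset_univ C) fun v _ hv => by rw [hout v hv, mul_zero]]
      exact sum_congr rfl fun v hv => by rw [subMat, if_pos ⟨hu, hv⟩]
    have hr1 : r (n + 1) = ∑ u ∈ C, (subMat q C ^ n : Matrix S S ℝ) s u * ∑ v, q u v * h v := by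
      have hexp : ∀ v, (subMat q C ^ (n + 1) : Matrix S S ℝ) s v =
          ∑ u ∈ C, (subMat q C ^ n : Matrix S S ℝ) s u * subMat q C u v := by
        intro v
        rw [pow_succ, Matrix.mul_apply]
        refine (sum_subset (subset_univ C) fun u _ hu => ?_).symm
        rw [subMat, if_neg fun h => hu h.1, mul_zero]
      simp only [hr, hexp, sum_mul]
      rw [sum_comm]
      refine sum_congr rfl fun u hu => ?_
      rw [← hsub u hu, mul_sum]
      exact sum_congr rfl fun v _ => mul_assoc _ _ _
    rw [hr1, ha, hr, ← sum_add_distrib]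
    refine sum_congr rfl fun u hu => ?_
    rw [hstep u hu]
    ring
  have hr_zero : r 0 = h s := by
    simp [hr, Matrix.one_apply, hs]
  have hpartial : ∀ n, ∑ i ∈ range n, a i = h s - r n := by
    intro n
    induction n with
    | zero => simp [hr_zero]
    | succ n ih => rw [sum_range_succ, ih, hrec n]; ring
  have hsummable : Summable a :=
    summable_of_sum_range_le ha0 fun n => by rw [hpartial]; linarith [hr0 n]
  have hrlim : Filter.Tendsto r Filter.atTop (nhds 0) := by
    refine squeeze_zero hr0 (g := fun n => a n * ∑ u, h u) (fun n => ?_) ?_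
    · rw [ha, sum_mul]
      exact sum_le_sum fun u _ => mul_le_mul_of_nonneg_left
        (single_le_sum (fun v _ => hnonneg v) (mem_univ u)) (subMat_pow_nonneg hq C n s u)
    · simpa using hsummable.tendsto_atTop_zero.mul_const (∑ u, h u)
  have hsum : HasSum a (h s) := by
    rw [hasSum_iff_tendsto_nat_of_nonneg ha0]
    simp only [hpartial]
    simpa using tendsto_const_nhds.sub hrlim
  rw [expExit, ← hsum.tsum_eq, ENNReal.ofReal_tsum_of_nonneg ha0 hsummable]

end ExitTime

/-- Freidlin–Wentzell: the expected exit time from `C` started at `s ∈ C` is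
`E_{s,q}[T_{C̄}] = (Σ_{G(C∖{s})} p(g) + Σ_{t∈C, t≠s} Σ_{G_{s,t}(C∖{t})} p(g)) / Σ_{G(C)} p(g)`. -/
theorem expected_exit_time_eq_graph_ratio
    (hcard : 2 ≤ Fintype.card S)
    (q : Matrix S S ℝ) (hq : IsTransition q) (hqirr : IsIrreducible q)
    (C : Finset S) (hCne : C.Nonempty) (hCproper : C ≠ Finset.univ)
    (s : S) (hs : s ∈ C) :
    expExit q C s = ENNReal.ofReal
      (((∑ g ∈ Gset (C.erase s), wt q (C.erase s) g) +
          ∑ t ∈ C.erase s, ∑ g ∈ GsetLead (C.erase t) s t, wt q (C.erase t) g) /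
        ∑ g ∈ Gset C, wt q C g) := by
  rw [← exitNumerator_eq q hs]
  have hW : 0 < ∑ g ∈ Gset C, wt q C g := sum_wt_Gset_pos hq hqirr hCproper
  refine expExit_eq_ofReal hq (h := fun u => exitNumerator q C u / ∑ g ∈ Gset C, wt q C g)
    (fun u => div_nonneg (exitNumerator_nonneg hq C u) hW.le)
    (fun u hu => by simp only [exitNumerator_eq_zero q hu, zero_div]) (fun u hu => ?_) hs
  simp only [mul_div_assoc', ← sum_div]
  rw [exitNumerator_step hq hu, add_div, div_self hW.ne']

end PerturbedMC
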